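/- arXiv:2008.01647 — 3 statements merged into one kernel-verified Lean document; each statement's English description precedes it below -/
import Mathlib

section
/- Let L, c', c*, h : ℕ → ℝ be sequences with L(t) ≥ 0 and h(t) ≥ 0 for all t, let B ∈ ℝ, V > 0 and ε ≥ 0, and suppose that for every t we have L(t+1) − L(t) + V·c'(t) ≤ B + V·c*(t) − ε·h(t). Then for every integer T ≥ 1, (1/T)·∑_{t=0}^{T−1} c'(t) ≤ B/V + L(0)/(V·T) + (1/T)·∑_{t=0}^{T−1} c*(t). -/
open Finset

/-- Finite-horizon time-average cost bound from the drift-plus-penalty inequality. -/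
theorem drift_plus_penalty_time_average_cost
    (L c' cstar h : ℕ → ℝ)
    (hL : ∀ t, 0 ≤ L t) (hh : ∀ t, 0 ≤ h t)
    (B V ε : ℝ) (hV : 0 < V) (hε : 0 ≤ ε)
    (hdrift : ∀ t, L (t + 1) - L t + V * c' t ≤ B + V * cstar t - ε * h t)
    (T : ℕ) (hT : 1 ≤ T) :
    (1 / (T : ℝ)) * ∑ t ∈ range T, c' t
      ≤ B / V + L 0 / (V * (T : ℝ)) + (1 / (T : ℝ)) * ∑ t ∈ range T, cstar t := by
  have key : ∀ n : ℕ, L n + V * ∑ t ∈ range n, c' t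
      ≤ n * B + L 0 + V * ∑ t ∈ range n, cstar t := by
    intro n
    induction n with
    | zero => simp
    | succ k ih =>
      rw [sum_range_succ, sum_range_succ]
      push_cast
      have h1 := hdrift k
      have h2 := mul_nonneg hε (hh k)
      linarith
  have hT' : (0 : ℝ) < T := by exact_mod_cast hT
  have hk := key T
  have hLT := hL T
  have e : B / V + L 0 / (V * (T : ℝ)) + (1 / (T : ℝ)) * ∑ t ∈ range T, cstar t
      = (T * B + L 0 + V * ∑ t ∈ range T, cstar t) / (V * T) := by
    field_simp
  have e2 : (1 / (T : ℝ)) * ∑ t ∈ range T, c' t = (V * ∑ t ∈ range T, c' t) / (V * T) := by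
    field_simp
  rw [e, e2]
  exact div_le_div_of_nonneg_right (by linarith) (by positivity)
end

section
/- Let L, c', h : ℕ → ℝ be sequences with L(t) ≥ 0 and h(t) ≥ 0 for all t, let B ∈ ℝ, V > 0, ε ≥ 0 and c* ∈ ℝ, and suppose that for every t we have L(t+1) − L(t) + V·c'(t) ≤ B + V·c* − ε·h(t). Then limsup_{T→∞} (1/T)·∑_{t=0}^{T−1} c'(t) ≤ B/V + c*. -/
open Finset Filter

/-- Time-average cost bound of the Lyapunov drift-plus-penalty analysis:
the long-run average cost is within `B/V` of the comparison cost `c*`. -/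
theorem drift_plus_penalty_limsup_cost
    (L c' h : ℕ → ℝ)
    (hL : ∀ t, 0 ≤ L t) (hh : ∀ t, 0 ≤ h t)
    (B V ε cstar : ℝ) (hV : 0 < V) (hε : 0 ≤ ε)
    (hdrift : ∀ t, L (t + 1) - L t + V * c' t ≤ B + V * cstar - ε * h t) :
    limsup (fun T : ℕ => (((1 / (T : ℝ)) * ∑ t ∈ range T, c' t : ℝ) : EReal)) atTop
      ≤ ((B / V + cstar : ℝ) : EReal) := by
  have hsum : ∀ T : ℕ, L T + V * ∑ t ∈ range T, c' t ≤ L 0 + T * (B + V * cstar) := by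
    intro T
    induction T with
    | zero => simp
    | succ n ih =>
      rw [Finset.sum_range_succ]
      push_cast
      have h1 := hdrift n
      have h2 := mul_nonneg hε (hh n)
      linarith
  have hlim : Tendsto (fun T : ℕ => (((B / V + cstar) + (L 0 / V) / (T : ℝ) : ℝ) : EReal))
      atTop (nhds ((B / V + cstar : ℝ) : EReal)) := by
    refine (continuous_coe_real_ereal.tendsto _).comp ?_
    have := (tendsto_const_div_atTop_nhds_zero_nat (L 0 / V)).const_add (B / V + cstar)
    simpa using this
  rw [← hlim.limsup_eq]
  refine limsup_le_limsup ?_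
  filter_upwards [eventually_gt_atTop 0] with T hT
  rw [EReal.coe_le_coe_iff]
  have hT' : (0 : ℝ) < T := by exact_mod_cast hT
  have h1 := hsum T
  have h2 := hL T
  have e : (B / V + cstar) + (L 0 / V) / (T : ℝ)
      = (1 / (T : ℝ)) * ((L 0 + T * (B + V * cstar)) / V) := by
    field_simp
    ring
  rw [e]
  refine mul_le_mul_of_nonneg_left ?_ (by positivity)
  rw [le_div_iff₀ hV]
  linarith
end

section
/- Let L, c', h : ℕ → ℝ be sequences with L(t) ≥ 0, c'(t) ≥ 0 and h(t) ≥ 0 for all t, let B ∈ ℝ, V ≥ 0, ε > 0 and c* ∈ ℝ, and suppose that for every t we have L(t+1) − L(t) + V·c'(t) ≤ B + V·c* − ε·h(t). Then limsup_{T→∞} (1/T)·∑_{t=0}^{T−1} h(t) ≤ (B + V·c*)/ε. -/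
open Finset Filter

/-- Time-average backlog bound of the Lyapunov drift-plus-penalty analysis:
the long-run average weighted total queue length is at most `(B + V·c*)/ε`. -/
theorem drift_plus_penalty_limsup_backlog
    (L c' h : ℕ → ℝ)
    (hL : ∀ t, 0 ≤ L t) (hc' : ∀ t, 0 ≤ c' t) (hh : ∀ t, 0 ≤ h t)
    (B V ε cstar : ℝ) (hV : 0 ≤ V) (hε : 0 < ε)
    (hdrift : ∀ t, L (t + 1) - L t + V * c' t ≤ B + V * cstar - ε * h t) :
    limsup (fun T : ℕ => (((1 / (T : ℝ)) * ∑ t ∈ range T, h t : ℝ) : EReal)) atTop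
      ≤ (((B + V * cstar) / ε : ℝ) : EReal) := by
  have key : ∀ T : ℕ, ε * ∑ t ∈ range T, h t ≤ T * (B + V * cstar) + L 0 - L T := by
    intro T
    induction T with
    | zero => simp
    | succ n ih =>
      rw [Finset.sum_range_succ, mul_add]
      push_cast
      have h1 := hdrift n
      have h2 := mul_nonneg hV (hc' n)
      linarith
  have hlim : Tendsto (fun T : ℕ => (B + V * cstar) / ε + (L 0 / ε) / (T : ℝ)) atTop
      (nhds ((B + V * cstar) / ε)) := by
    simpa using (tendsto_const_div_atTop_nhds_zero_nat (L 0 / ε)).const_add ((B + V * cstar) / ε)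
  have hlim' := (continuous_coe_real_ereal.tendsto _).comp hlim
  rw [← hlim'.limsup_eq]
  refine limsup_le_limsup ?_
  · filter_upwards [eventually_gt_atTop 0] with T hT
    have hT' : (0 : ℝ) < T := by exact_mod_cast hT
    simp only [Function.comp]
    rw [EReal.coe_le_coe_iff]
    have h1 := key T
    have h2 := hL T
    have h3 : (B + V * cstar) / ε + (L 0 / ε) / (T : ℝ)
        = (T * (B + V * cstar) + L 0) / (ε * T) := by
      field_simp
    rw [h3, le_div_iff₀ (by positivity)]
    have h4 : 1 / (T : ℝ) * (∑ t ∈ range T, h t) * (ε * T) = ε * ∑ t ∈ range T, h t := by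
      field_simp
    rw [h4]
    linarith
end
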